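/- Let P ⊂ ℝ^d be a centrally symmetric lattice polytope. Then for every c ∈ ℚ^d, the Ehrhart quasi-polynomial L_{c+P}(t) = #(t(c+P) ∩ ℤ^d) is symmetric with respect to the period ρ = den(c): its k-th and (ρ−k)-th constituents coincide for all 0 ≤ k ≤ ρ. Equivalently, #((kc + tP) ∩ ℤ^d) = #((−kc + tP) ∩ ℤ^d) for all integers k and all positive integers t. -/

import Mathlib

open Pointwise MeasureTheory
open scoped RealInnerProductSpace

noncomputable section

/-- Cast an integer vector to a real vector. -/
def castVec {d : ℕ} (x : Fin d → ℤ) : Fin d → ℝ := fun i => (x i : ℝ)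

/-- Cast a rational vector to a real vector. -/
def ratVec {d : ℕ} (c : Fin d → ℚ) : Fin d → ℝ := fun i => (c i : ℝ)

/-- `den(c)`: the lcm of the denominators of the coordinates of a rational vector. -/
def denv {d : ℕ} (c : Fin d → ℚ) : ℕ := Finset.univ.lcm fun i => (c i).den

/-- The number of lattice points in a subset of `ℝ^d`. -/
def latCount {d : ℕ} (S : Set (Fin d → ℝ)) : ℕ := {x : Fin d → ℤ | castVec x ∈ S}.ncard

/-- A lattice polytope: the convex hull of a nonempty finite set of integer points. -/
def IsLatticePolytope {d : ℕ} (P : Set (Fin d → ℝ)) : Prop :=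
  ∃ V : Finset (Fin d → ℤ), V.Nonempty ∧ P = convexHull ℝ (castVec '' (V : Set (Fin d → ℤ)))

/-- The zonotope spanned by a finite set of integer vectors. -/
def zonotopeF {d : ℕ} (U : Finset (Fin d → ℤ)) : Set (Fin d → ℝ) :=
  {x | ∃ lam : (Fin d → ℤ) → ℝ, (∀ u, lam u ∈ Set.Icc (0 : ℝ) 1) ∧
    x = ∑ u ∈ U, lam u • castVec u}

/-- The zonotope spanned by integer vectors `u 0, …, u (n-1)`. -/
def zonotopeZ {d n : ℕ} (u : Fin n → Fin d → ℤ) : Set (Fin d → ℝ) :=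
  {x | ∃ lam : Fin n → ℝ, (∀ i, lam i ∈ Set.Icc (0 : ℝ) 1) ∧ x = ∑ i, lam i • castVec (u i)}

/-- The zonotope spanned by real vectors `u 0, …, u (n-1)`. -/
def zonotopeR {d n : ℕ} (u : Fin n → Fin d → ℝ) : Set (Fin d → ℝ) :=
  {x | ∃ lam : Fin n → ℝ, (∀ i, lam i ∈ Set.Icc (0 : ℝ) 1) ∧ x = ∑ i, lam i • u i}

/-- A zonotope: a translate of the Minkowski sum of finitely many segments `[0, uᵢ]`. -/
def IsZonotope {d : ℕ} (P : Set (Fin d → ℝ)) : Prop :=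
  ∃ (n : ℕ) (u : Fin n → Fin d → ℝ) (v : Fin d → ℝ), P = v +ᵥ zonotopeR u

/-- A set is centrally symmetric if it is a translate of its negation. -/
def CentrallySymmetric {d : ℕ} (P : Set (Fin d → ℝ)) : Prop :=
  ∃ v : Fin d → ℝ, P = v +ᵥ (-P)

/-- `f` is a family of constituents of `L` with respect to the period `ρ`. -/
def IsConstituents (L : ℕ → ℚ) (ρ : ℕ) (f : ℕ → Polynomial ℚ) : Prop :=
  ∀ t : ℕ, 0 < t → L t = (f (t % ρ)).eval (t : ℚ)

/-- `ρ` is a period of the quasi-polynomial `L`. -/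
def IsPeriodOf (ρ : ℕ) (L : ℕ → ℚ) : Prop := 0 < ρ ∧ ∃ f, IsConstituents L ρ f

/-- `ρ₀` is the minimal period of the quasi-polynomial `L`. -/
def IsMinimalPeriodOf (ρ₀ : ℕ) (L : ℕ → ℚ) : Prop :=
  IsPeriodOf ρ₀ L ∧ ∀ ρ : ℕ, IsPeriodOf ρ L → ρ₀ ≤ ρ

/-- GCD-property with respect to the period `ρ`: constituents with equal
`gcd(ρ, ·)` coincide. -/
def GCDProperty (L : ℕ → ℚ) (ρ : ℕ) : Prop :=
  ∀ f : ℕ → Polynomial ℚ, IsConstituents L ρ f →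
    ∀ k ℓ : ℕ, Nat.gcd ρ k = Nat.gcd ρ ℓ → f (k % ρ) = f (ℓ % ρ)

/-- Symmetry with respect to the period `ρ`: `f_k = f_{ρ-k}` for `0 ≤ k ≤ ρ`. -/
def SymmetricQP (L : ℕ → ℚ) (ρ : ℕ) : Prop :=
  ∀ f : ℕ → Polynomial ℚ, IsConstituents L ρ f →
    ∀ k : ℕ, k ≤ ρ → f (k % ρ) = f ((ρ - k) % ρ)

/-- The Ehrhart counting function `t ↦ #(t(c + P) ∩ ℤ^d)` of the translate `c + P`. -/
def ehr {d : ℕ} (P : Set (Fin d → ℝ)) (c : Fin d → ℚ) : ℕ → ℚ :=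
  fun t => (latCount ((t : ℝ) • (ratVec c +ᵥ P)) : ℚ)

/-- The dimension of a polytope: the dimension of the direction of its affine hull. -/
def polyDim {d : ℕ} (P : Set (Fin d → ℝ)) : ℕ := Module.finrank ℝ (affineSpan ℝ P).direction

/-- `r` is the relative volume of `P` (of dimension `m`): with respect to any lattice
point `v₀` of `P` and any `ℤ`-basis `b` of the lattice `aff₀(P) ∩ ℤ^d`, `r` is the
Lebesgue measure of `P` in the coordinates determined by `v₀` and `b`. -/
def IsRelVolOf {d : ℕ} (P : Set (Fin d → ℝ)) (m : ℕ) (r : ℝ) : Prop :=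
  ∀ (v₀ : Fin d → ℤ) (b : Fin m → Fin d → ℤ),
    castVec v₀ ∈ P → LinearIndependent ℤ b →
    (∀ x : Fin d → ℤ,
      castVec x ∈ (affineSpan ℝ P).direction ↔ x ∈ Submodule.span ℤ (Set.range b)) →
    r = (volume {lam : Fin m → ℝ | castVec v₀ + ∑ i, lam i • castVec (b i) ∈ P}).toReal

/-- The (real casts of the) elements of `W` are linearly independent over `ℝ`. -/
def LinIndepF {d : ℕ} (W : Finset (Fin d → ℤ)) : Prop :=
  LinearIndependent ℝ fun w : ↥W => castVec w.1

/-- Almost locally constant: locally constant outside a discrete point set. -/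
def AlmostLocallyConstant (f : ℝ → ℝ) : Prop :=
  ∃ D : Set ℝ, DiscreteTopology D ∧ IsLocallyConstant fun x : ↥(Dᶜ) => f ↑x

/-- Almost constant: constant outside a discrete point set. -/
def AlmostConstant (f : ℝ → ℝ) : Prop :=
  ∃ D : Set ℝ, DiscreteTopology D ∧ ∃ r : ℝ, ∀ x ∉ D, f x = r

/-- The face of `P` in the outer normal direction `v`. -/
def normalFace {d : ℕ} (P : Set (EuclideanSpace ℝ (Fin d)))
    (v : EuclideanSpace ℝ (Fin d)) : Set (EuclideanSpace ℝ (Fin d)) :=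
  {x | x ∈ P ∧ ∀ y ∈ P, ⟪y, v⟫ ≤ ⟪x, v⟫}

/-- `F` is a facet of the `d`-polytope `P`: an exposed face of dimension `d - 1`. -/
def IsFacetOf {d : ℕ} (F P : Set (EuclideanSpace ℝ (Fin d))) : Prop :=
  (∃ v : EuclideanSpace ℝ (Fin d), v ≠ 0 ∧ F = normalFace P v) ∧
  Module.finrank ℝ (affineSpan ℝ F).direction = d - 1
/-- A sequence of rationals that agrees with a polynomial at all large arguments. -/
def EventuallyPolynomial (g : ℕ → ℚ) : Prop :=
  ∃ p : Polynomial ℚ, ∀ᶠ t : ℕ in Filter.atTop, g t = p.eval (t : ℚ)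

namespace EventuallyPolynomial

lemma congr {g h : ℕ → ℚ} (hg : EventuallyPolynomial g) (hgh : ∀ᶠ t in Filter.atTop, h t = g t) :
    EventuallyPolynomial h := by
  obtain ⟨p, hp⟩ := hg
  exact ⟨p, by filter_upwards [hp, hgh] with t h1 h2 using h2.trans h1⟩

lemma add {g h : ℕ → ℚ} (hg : EventuallyPolynomial g) (hh : EventuallyPolynomial h) :
    EventuallyPolynomial fun t => g t + h t := by
  obtain ⟨p, hp⟩ := hg
  obtain ⟨q, hq⟩ := hh
  exact ⟨p + q, by filter_upwards [hp, hq] with t h1 h2; simp [h1, h2]⟩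

lemma sub {g h : ℕ → ℚ} (hg : EventuallyPolynomial g) (hh : EventuallyPolynomial h) :
    EventuallyPolynomial fun t => g t - h t := by
  obtain ⟨p, hp⟩ := hg
  obtain ⟨q, hq⟩ := hh
  exact ⟨p - q, by filter_upwards [hp, hq] with t h1 h2; simp [h1, h2]⟩

lemma comp_sub {g : ℕ → ℚ} (hg : EventuallyPolynomial g) (m : ℕ) :
    EventuallyPolynomial fun t => g (t - m) := by
  obtain ⟨p, hp⟩ := hg
  refine ⟨p.comp (Polynomial.X - Polynomial.C (m : ℚ)), ?_⟩
  filter_upwards [(Filter.tendsto_sub_atTop_nat m).eventually hp, Filter.eventually_ge_atTop m]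
    with t h1 h2
  simp [h1, Nat.cast_sub h2]

end EventuallyPolynomial

lemma finite_setOf_sum_eq (n t : ℕ) : {a : Fin n → ℕ | ∑ i, a i = t}.Finite :=
  (Set.finite_Iic (fun _ : Fin n => t)).subset fun a ha i => by
    have h : ∑ i, a i = t := ha
    simpa [h] using Finset.single_le_sum (f := a) (fun _ _ => Nat.zero_le _) (Finset.mem_univ i)

lemma eventuallyPolynomial_ncard_sum_eq (n : ℕ) :
    EventuallyPolynomial fun t => ({a : Fin n → ℕ | ∑ i, a i = t}.ncard : ℚ) := by
  have hcard (t : ℕ) : {a : Fin n → ℕ | ∑ i, a i = t}.ncard = (n + t - 1).choose t := by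
    change Nat.card {a : Fin n → ℕ // ∑ i, a i = t} = _
    rw [← Nat.card_congr (Sym.equivNatSumOfFintype (Fin n) t), Nat.card_eq_fintype_card,
      Sym.card_sym_eq_choose, Fintype.card_fin]
  simp_rw [hcard]
  cases n with
  | zero =>
    refine ⟨0, ?_⟩
    filter_upwards [Filter.eventually_gt_atTop 0] with t ht
    rw [Nat.choose_eq_zero_of_lt (by omega)]
    simp
  | succ d =>
    refine ⟨Polynomial.preHilbertPoly ℚ d 0, Filter.Eventually.of_forall fun t => ?_⟩
    dsimp only
    rw [Polynomial.preHilbertPoly_eq_choose_sub_add ℚ d (Nat.zero_le t), Nat.sub_zero,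
      show d + 1 + t - 1 = t + d by omega, Nat.choose_symm_add]

/-- Exponent vectors of a given degree avoiding a finitely generated monomial ideal are counted by
an eventually polynomial function. -/
lemma eventuallyPolynomial_ncard_avoiding {n : ℕ} (k : ℕ) :
    ∀ L : List (Fin n → ℕ), L.length = k → EventuallyPolynomial fun t =>
      ({a : Fin n → ℕ | ∑ i, a i = t ∧ ∀ b ∈ L, ¬ b ≤ a}.ncard : ℚ) := by
  induction k with
  | zero =>
    intro L hL
    rw [List.length_eq_zero_iff] at hL
    simpa [hL] using eventuallyPolynomial_ncard_sum_eq n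
  | succ k ih =>
    rintro (_ | ⟨b, L⟩) hL
    · simp at hL
    · have hL' : L.length = k := by simpa using hL
      refine ((ih L hL').sub ((ih (L.map fun c => c - b) (by simpa)).comp_sub (∑ i, b i))).congr ?_
      filter_upwards [Filter.eventually_ge_atTop (∑ i, b i)] with t ht
      rw [eq_sub_iff_add_eq]
      norm_cast
      have himage : {a : Fin n → ℕ | (∑ i, a i = t ∧ ∀ c ∈ L, ¬ c ≤ a) ∧ b ≤ a} =
          (fun a => b + a) '' {a : Fin n → ℕ | ∑ i, a i = t - ∑ i, b i ∧
            ∀ c ∈ L.map fun c => c - b, ¬ c ≤ a} := by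
        ext a
        constructor
        · rintro ⟨⟨h1, h2⟩, h3⟩
          obtain ⟨a, rfl⟩ := exists_add_of_le h3
          refine ⟨a, ⟨?_, ?_⟩, rfl⟩
          · simp only [Pi.add_apply, Finset.sum_add_distrib] at h1
            omega
          · simpa [add_comm b] using h2
        · rintro ⟨a, ⟨h1, h2⟩, rfl⟩
          refine ⟨⟨?_, ?_⟩, le_self_add⟩
          · simp only [Pi.add_apply, Finset.sum_add_distrib]
            omega
          · simpa [add_comm b] using h2
      rw [← Set.ncard_image_of_injective {a | _ = t - _ ∧ _} (add_right_injective b), ← himage,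
        ← Set.ncard_union_eq ?_ ?_ ?_]
      · congr 1
        ext a
        simp only [List.mem_cons, forall_eq_or_imp, Set.mem_union, Set.mem_ofPred_eq]
        tauto
      · rw [Set.disjoint_left]
        rintro a ⟨-, h⟩ ⟨-, h'⟩
        exact h b (by simp) h'
      · exact (finite_setOf_sum_eq n t).subset fun a h => h.1
      · exact (finite_setOf_sum_eq n t).subset fun a h => h.1.1

lemma eventuallyPolynomial_ncard_compl_upperSet {n : ℕ} {U : Set (Fin n → ℕ)} (hU : IsUpperSet U) :
    EventuallyPolynomial fun t => ({a : Fin n → ℕ | ∑ i, a i = t ∧ a ∉ U}.ncard : ℚ) := by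
  have hfin : {b | Minimal (· ∈ U) b}.Finite :=
    WellQuasiOrderedLE.finite_of_isAntichain (setOfPred_minimal_antichain _)
  have hmem (a : Fin n → ℕ) : a ∉ U ↔ ∀ b ∈ hfin.toFinset.toList, ¬ b ≤ a := by
    simp only [Finset.mem_toList, Set.Finite.mem_toFinset, Set.mem_ofPred_eq]
    refine ⟨fun ha b hb hba => ha (hU hba hb.prop), fun h ha => ?_⟩
    obtain ⟨b, hba, hb⟩ := exists_minimal_le_of_wellFoundedLT (· ∈ U) a ha
    exact h b hb hba
  simp_rw [hmem]
  exact eventuallyPolynomial_ncard_avoiding _ _ rfl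

/-- A graded form of Khovanskii's theorem: the number of elements of degree `t` in the finitely
generated set `F + ℕ v₁ + ⋯ + ℕ vₙ` is eventually polynomial in `t`, if all `vᵢ` have degree `1`. -/
lemma eventuallyPolynomial_ncard_graded {G : Type*} [AddCommGroup G] {n : ℕ} (v : Fin n → G)
    (deg : G →+ ℤ) (hv : ∀ i, deg (v i) = 1) (F : Finset G) (hF : ∀ f ∈ F, 0 ≤ deg f) :
    EventuallyPolynomial fun t => ({g | deg g = t ∧
      ∃ f ∈ F, ∃ a : Fin n → ℕ, g = f + ∑ i, a i • v i}.ncard : ℚ) := by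
  classical
  have hdeg (a : Fin n → ℕ) : deg (∑ i, a i • v i) = ((∑ i, a i : ℕ) : ℤ) := by
    simp [hv]
  induction F using Finset.induction_on with
  | empty => exact ⟨0, Filter.Eventually.of_forall fun t => by simp⟩
  | insert f F hf ih =>
    have ih := ih fun f' h => hF f' (Finset.mem_insert_of_mem h)
    obtain ⟨m, hm⟩ := Int.eq_ofNat_of_zero_le (hF f (Finset.mem_insert_self f F))
    let U : Set (Fin n → ℕ) := {a |
      (∃ f' ∈ F, ∃ a' : Fin n → ℕ, f + ∑ i, a i • v i = f' + ∑ i, a' i • v i) ∨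
      ∃ a' : Fin n → ℕ, toLex a' < toLex a ∧ ∑ i, a' i • v i = ∑ i, a i • v i}
    have hU : IsUpperSet U := by
      rintro a b hab ha
      obtain ⟨c, rfl⟩ := exists_add_of_le hab
      rcases ha with ⟨f', hf', a', h⟩ | ⟨a', hlt, h⟩
      · refine Or.inl ⟨f', hf', a' + c, ?_⟩
        simp only [Pi.add_apply, add_smul, Finset.sum_add_distrib, ← add_assoc, h]
      · refine Or.inr ⟨a' + c, ?_, ?_⟩
        · simpa using add_lt_add_left hlt (toLex c)
        · simp only [Pi.add_apply, add_smul, Finset.sum_add_distrib, h]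
    refine (ih.add ((eventuallyPolynomial_ncard_compl_upperSet hU).comp_sub m)).congr ?_
    filter_upwards [Filter.eventually_ge_atTop m] with t ht
    norm_cast
    have hinj : Set.InjOn (fun a : Fin n → ℕ => f + ∑ i, a i • v i)
        {a | ∑ i, a i = t - m ∧ a ∉ U} := by
      rintro a ⟨-, ha⟩ b ⟨-, hb⟩ hab
      have hab : ∑ i, a i • v i = ∑ i, b i • v i := add_left_cancel hab
      rcases lt_trichotomy (toLex a) (toLex b) with h | h | h
      · exact absurd (Or.inr ⟨a, h, hab⟩) hb
      · exact toLex.injective h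
      · exact absurd (Or.inr ⟨b, h, hab.symm⟩) ha
    rw [← hinj.ncard_image, ← Set.ncard_union_eq ?_ ?_ ?_]
    · congr 1
      ext g
      constructor
      · rintro ⟨hg, f', hf', a, rfl⟩
        by_cases hgF : ∃ f'' ∈ F, ∃ b : Fin n → ℕ,
            f' + ∑ i, a i • v i = f'' + ∑ i, b i • v i
        · exact Or.inl ⟨hg, hgF⟩
        rcases Finset.mem_insert.1 hf' with rfl | hf'
        · right
          obtain ⟨b, hb, hmin⟩ := (wellFounded_lt (α := Lex (Fin n → ℕ))).has_min
            {b | ∑ i, ofLex b i • v i = ∑ i, a i • v i} ⟨toLex a, rfl⟩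
          have hb : ∑ i, ofLex b i • v i = ∑ i, a i • v i := hb
          refine ⟨ofLex b, ⟨?_, ?_⟩, by simp only [hb]⟩
          · rw [← hb, map_add, hdeg, hm] at hg
            omega
          · rintro (h | ⟨c, hc, h⟩)
            · rw [hb] at h
              exact hgF h
            · exact hmin (toLex c) (h.trans hb) hc
        · exact absurd ⟨f', hf', a, rfl⟩ hgF
      · rintro (⟨hg, f', hf', h⟩ | ⟨a, ⟨ha, -⟩, rfl⟩)
        · exact ⟨hg, f', Finset.mem_insert_of_mem hf', h⟩
        · refine ⟨?_, f, Finset.mem_insert_self f F, a, rfl⟩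
          simp only [map_add, hdeg, hm, ha]
          omega
    · rw [Set.disjoint_left]
      rintro _ ⟨-, h⟩ ⟨a, ⟨-, ha⟩, rfl⟩
      exact ha (Or.inl h)
    · refine (Set.Finite.image2 (fun f (a : Fin n → ℕ) => f + ∑ i, a i • v i) F.finite_toSet
        (Set.finite_Iic (fun _ => t))).subset ?_
      rintro g ⟨hg, f', hf', a, rfl⟩
      refine ⟨f', hf', a, fun i => ?_, rfl⟩
      have h1 := hF f' (Finset.mem_insert_of_mem hf')
      have h2 := Finset.single_le_sum (f := a) (fun _ _ => Nat.zero_le _) (Finset.mem_univ i)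
      rw [map_add, hdeg] at hg
      change a i ≤ t
      omega
    · exact ((finite_setOf_sum_eq n (t - m)).subset fun a h => h.1).image _

section castVec

variable {d : ℕ}

lemma castVec_add (x y : Fin d → ℤ) : castVec (x + y) = castVec x + castVec y := by
  ext i
  simp [castVec]

lemma castVec_sub (x y : Fin d → ℤ) : castVec (x - y) = castVec x - castVec y := by
  ext i
  simp [castVec]

lemma castVec_sum_nsmul {n : ℕ} (a : Fin n → ℕ) (v : Fin n → Fin d → ℤ) :
    castVec (∑ i, a i • v i) = ∑ i, (a i : ℝ) • castVec (v i) := by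
  ext j
  simp [castVec, Finset.sum_apply]

end castVec

lemma finite_setOf_castVec_mem {d : ℕ} {S : Set (Fin d → ℝ)} (hS : Bornology.IsBounded S) :
    {x : Fin d → ℤ | castVec x ∈ S}.Finite := by
  obtain ⟨R, hR⟩ := hS.exists_norm_le
  refine (Set.finite_Icc (fun _ : Fin d => -⌈R⌉) (fun _ => ⌈R⌉)).subset fun x hx => ?_
  have hbound (i : Fin d) : |x i| ≤ ⌈R⌉ := by
    have h := ((norm_le_pi_norm (castVec x) i).trans (hR _ hx)).trans (Int.le_ceil R)
    rw [castVec, Real.norm_eq_abs] at h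
    exact_mod_cast h
  exact ⟨fun i => (abs_le.1 (hbound i)).1, fun i => (abs_le.1 (hbound i)).2⟩

lemma mem_smul_convexHull_range {E : Type*} [AddCommGroup E] [Module ℝ E] {n : ℕ} [NeZero n]
    (v : Fin n → E) {s : ℝ} (hs : 0 ≤ s) {x : E} :
    x ∈ s • convexHull ℝ (Set.range v) ↔
      ∃ l : Fin n → ℝ, (∀ i, 0 ≤ l i) ∧ ∑ i, l i = s ∧ x = ∑ i, l i • v i := by
  constructor
  · rintro ⟨y, hy, rfl⟩
    have hle : convexHull ℝ (Set.range v) ⊆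
        Fintype.linearCombination ℝ v '' stdSimplex ℝ (Fin n) := by
      refine convexHull_min ?_ ((convex_stdSimplex ℝ (Fin n)).linear_image _)
      rintro _ ⟨i, rfl⟩
      exact ⟨Pi.single i 1, single_mem_stdSimplex ℝ i, by simp⟩
    obtain ⟨l, ⟨hl, hl1⟩, rfl⟩ := hle hy
    refine ⟨s • l, fun i => mul_nonneg hs (hl i), ?_, ?_⟩
    · simp [← Finset.mul_sum, hl1]
    · simp [Fintype.linearCombination_apply, Finset.smul_sum, smul_smul]
  · rintro ⟨l, hl, hls, rfl⟩
    rcases hs.eq_or_lt with rfl | hs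
    · have hl0 : ∀ i, l i = 0 := by
        simpa using (Finset.sum_eq_zero_iff_of_nonneg fun i _ => hl i).1 hls
      exact ⟨v 0, subset_convexHull ℝ _ ⟨0, rfl⟩, by simp [hl0]⟩
    · refine ⟨∑ i, (s⁻¹ * l i) • v i, ?_, ?_⟩
      · refine mem_convexHull_of_exists_fintype (fun i => s⁻¹ * l i) v
          (fun i => mul_nonneg (inv_nonneg.2 hs.le) (hl i)) ?_ (fun i => ⟨i, rfl⟩) rfl
        rw [← Finset.mul_sum, hls, inv_mul_cancel₀ hs.ne']
      · simp [Finset.smul_sum, smul_smul, mul_inv_cancel_left₀ hs.ne']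

lemma IsLatticePolytope.exists_fin {d : ℕ} {P : Set (Fin d → ℝ)} (hP : IsLatticePolytope P) :
    ∃ (n : ℕ) (_ : NeZero n) (v : Fin n → Fin d → ℤ),
      P = convexHull ℝ (Set.range fun i => castVec (v i)) := by
  obtain ⟨V, hV, rfl⟩ := hP
  refine ⟨V.card, ⟨hV.card_pos.ne'⟩, fun i => (V.equivFin.symm i).1, ?_⟩
  congr 1
  ext y
  constructor
  · rintro ⟨x, hx, rfl⟩
    exact ⟨V.equivFin ⟨x, hx⟩, by simp⟩
  · rintro ⟨i, rfl⟩
    exact ⟨_, (V.equivFin.symm i).2, rfl⟩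

lemma IsLatticePolytope.isCompact {d : ℕ} {P : Set (Fin d → ℝ)} (hP : IsLatticePolytope P) :
    IsCompact P := by
  obtain ⟨V, -, rfl⟩ := hP
  exact (V.finite_toSet.image _).isCompact_convexHull ℝ

/-- Ehrhart's theorem for a translated dilate of a lattice polytope: the number of lattice points
of `w + tP` is eventually polynomial in `t`. -/
theorem IsLatticePolytope.eventuallyPolynomial_latCount {d : ℕ} {P : Set (Fin d → ℝ)}
    (hP : IsLatticePolytope P) (w : Fin d → ℝ) :
    EventuallyPolynomial fun t => (latCount (w +ᵥ (t : ℝ) • P) : ℚ) := by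
  have hbdd (s : ℝ) : Bornology.IsBounded (w +ᵥ s • P) :=
    ((hP.isCompact.smul s).vadd w).isBounded
  obtain ⟨n, _, v, hPv⟩ := hP.exists_fin
  have hmem (s : ℤ) (hs : 0 ≤ s) (x : Fin d → ℤ) : castVec x ∈ w +ᵥ (s : ℝ) • P ↔
      ∃ l : Fin n → ℝ, (∀ i, 0 ≤ l i) ∧ ∑ i, l i = s ∧
        castVec x = w + ∑ i, l i • castVec (v i) := by
    rw [Set.mem_vadd_set_iff_neg_vadd_mem, hPv,
      mem_smul_convexHull_range _ (by exact_mod_cast hs)]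
    simp only [vadd_eq_add, neg_add_eq_iff_eq_add]
  have hfin : {f : ℤ × (Fin d → ℤ) | f.1 ∈ Set.Icc 0 (n : ℤ) ∧
      castVec f.2 ∈ w +ᵥ (f.1 : ℝ) • P}.Finite := by
    refine ((Set.finite_Icc 0 (n : ℤ)).biUnion fun s _ =>
      (finite_setOf_castVec_mem (hbdd s)).image (Prod.mk s)).subset ?_
    rintro ⟨s, x⟩ ⟨hs, hx⟩
    exact Set.mem_biUnion hs ⟨x, hx, rfl⟩
  refine (eventuallyPolynomial_ncard_graded (fun i => ((1 : ℤ), v i)) (AddMonoidHom.fst _ _)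
    (fun _ => rfl) hfin.toFinset (fun f hf => ((hfin.mem_toFinset.1 hf).1.1))).congr
    (Filter.Eventually.of_forall fun t => ?_)
  rw [latCount, ← Set.ncard_image_of_injective _ (Prod.mk_right_injective (t : ℤ))]
  congr 2
  have hsum (a : Fin n → ℕ) : ∑ i, a i • ((1 : ℤ), v i) = (∑ i, (a i : ℤ), ∑ i, a i • v i) := by
    ext <;> simp [Prod.fst_sum, Prod.snd_sum]
  ext ⟨s, x⟩
  constructor
  · rintro ⟨x, hx, h⟩
    cases h
    obtain ⟨l, hl, hlt, hx⟩ := (hmem t (by positivity) x).1 hx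
    refine ⟨rfl, (t - ∑ i, (⌊l i⌋₊ : ℤ), x - ∑ i, ⌊l i⌋₊ • v i), ?_, fun i => ⌊l i⌋₊, ?_⟩
    · have hfract : ∑ i, (l i - ⌊l i⌋₊) = ((t - ∑ i, (⌊l i⌋₊ : ℤ) : ℤ) : ℝ) := by
        push_cast
        rw [Finset.sum_sub_distrib, hlt, Int.cast_natCast]
      have h0 : ∀ i, 0 ≤ l i - ⌊l i⌋₊ := fun i => sub_nonneg.2 (Nat.floor_le (hl i))
      have h1 : ∑ i, (l i - ⌊l i⌋₊) ≤ n := by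
        calc ∑ i, (l i - ⌊l i⌋₊) ≤ ∑ _i : Fin n, (1 : ℝ) :=
              Finset.sum_le_sum fun i _ => by linarith [Nat.lt_floor_add_one (l i)]
          _ = n := by simp
      have hnonneg : (0 : ℤ) ≤ t - ∑ i, (⌊l i⌋₊ : ℤ) := by
        have := hfract ▸ Finset.sum_nonneg fun i _ => h0 i
        exact_mod_cast this
      refine hfin.mem_toFinset.2 ⟨⟨hnonneg, ?_⟩, ?_⟩
      · rw [hfract] at h1
        exact_mod_cast h1
      · refine (hmem _ hnonneg _).2 ⟨fun i => l i - ⌊l i⌋₊, h0, hfract, ?_⟩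
        simp only [castVec_sub, castVec_sum_nsmul, hx, sub_smul, Finset.sum_sub_distrib]
        abel
    · rw [hsum]
      simp
  · rintro ⟨hs, ⟨s', y⟩, hf, a, h⟩
    obtain ⟨⟨hs0, -⟩, hy⟩ := hfin.mem_toFinset.1 hf
    obtain ⟨l, hl, hls, hy⟩ := (hmem s' hs0 y).1 hy
    rw [hsum, Prod.mk_add_mk, Prod.mk.injEq] at h
    obtain ⟨h1, rfl⟩ := h
    obtain rfl : s = t := hs
    refine ⟨_, (hmem t (by positivity) _).2
      ⟨fun i => l i + a i, fun i => add_nonneg (hl i) (Nat.cast_nonneg _), ?_, ?_⟩, rfl⟩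
    · rw [Finset.sum_add_distrib, hls, h1]
      push_cast
      rfl
    · simp only [castVec_add, castVec_sum_nsmul, hy, add_smul, Finset.sum_add_distrib, add_assoc]

lemma CentrallySymmetric.exists_castVec {d : ℕ} {P : Set (Fin d → ℝ)} (hP : IsLatticePolytope P)
    (hsym : CentrallySymmetric P) : ∃ v : Fin d → ℤ, ∀ x, x ∈ P ↔ castVec v - x ∈ P := by
  obtain ⟨v, hv⟩ := hsym
  have hv (x : Fin d → ℝ) : x ∈ P ↔ v - x ∈ P := by
    nth_rewrite 1 [hv]
    rw [Set.mem_vadd_set_iff_neg_vadd_mem, Set.mem_neg, vadd_eq_add, neg_add, neg_neg,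
      sub_eq_add_neg]
  have hcomp := hP.isCompact
  obtain ⟨V, hV, rfl⟩ := hP
  obtain ⟨x, hx⟩ := hcomp.extremePoints_nonempty ((hV.to_set.image _).convexHull (𝕜 := ℝ))
  have hx' : v - x ∈ (convexHull ℝ (castVec '' (V : Set (Fin d → ℤ)))).extremePoints ℝ := by
    refine ⟨(hv x).1 hx.1, fun y hy z hz h => ?_⟩
    have := hx.2 ((hv y).1 hy) ((hv z).1 hz) (by
      obtain ⟨a, b, ha, hb, hab, h⟩ := h
      refine ⟨a, b, ha, hb, hab, ?_⟩
      rw [smul_sub, smul_sub, sub_add_sub_comm, ← add_smul, hab, h, one_smul, sub_sub_cancel])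
    rw [← this, sub_sub_cancel]
  obtain ⟨y, -, hy⟩ := extremePoints_convexHull_subset hx
  obtain ⟨z, -, hz⟩ := extremePoints_convexHull_subset hx'
  obtain rfl : v = castVec (y + z) := by
    rw [castVec_add, hy, hz, add_sub_cancel]
  exact ⟨y + z, hv⟩

lemma latCount_castVec_vadd {d : ℕ} (m : Fin d → ℤ) (S : Set (Fin d → ℝ)) :
    latCount (castVec m +ᵥ S) = latCount S := by
  rw [latCount, latCount, ← Set.ncard_image_of_injective {x | castVec x ∈ S} (add_right_injective m)]
  congr 1
  ext x
  simp only [Set.mem_vadd_set_iff_neg_vadd_mem, vadd_eq_add, Set.mem_image, Set.mem_ofPred_eq]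
  constructor
  · intro h
    refine ⟨x - m, ?_, add_sub_cancel m x⟩
    rwa [castVec_sub, sub_eq_neg_add]
  · rintro ⟨y, hy, rfl⟩
    rwa [castVec_add, neg_add_cancel_left]

lemma latCount_vadd_smul_eq_neg {d : ℕ} {P : Set (Fin d → ℝ)} (hP : IsLatticePolytope P)
    (hsym : CentrallySymmetric P) (w : Fin d → ℝ) (t : ℕ) :
    latCount (w +ᵥ (t : ℝ) • P) = latCount (-w +ᵥ (t : ℝ) • P) := by
  obtain ⟨v, hv⟩ := hsym.exists_castVec hP
  have hcast : castVec ((t : ℕ) • v) = (t : ℝ) • castVec v := by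
    ext i
    simp [castVec]
  rw [latCount, latCount, ← Set.ncard_image_of_injective {x | castVec x ∈ w +ᵥ (t : ℝ) • P}
    (sub_right_injective (b := t • v))]
  congr 1
  have key (w x : Fin d → ℝ) (hx : x ∈ w +ᵥ (t : ℝ) • P) :
      (t : ℝ) • castVec v - x ∈ -w +ᵥ (t : ℝ) • P := by
    obtain ⟨_, ⟨y, hy, rfl⟩, rfl⟩ := hx
    refine ⟨_, ⟨_, (hv y).1 hy, rfl⟩, ?_⟩
    simp only [vadd_eq_add, smul_sub]
    abel
  ext x
  refine ⟨?_, fun hx => ?_⟩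
  · rintro ⟨y, hy, rfl⟩
    have h := key w (castVec y) hy
    rwa [← hcast, ← castVec_sub] at h
  · refine ⟨t • v - x, ?_, sub_sub_cancel _ x⟩
    have h := key (-w) (castVec x) hx
    rwa [neg_neg, ← hcast, ← castVec_sub] at h

lemma denv_pos {d : ℕ} (c : Fin d → ℚ) : 0 < denv c := by
  rw [Nat.pos_iff_ne_zero, denv, Ne, Finset.lcm_eq_zero_iff]
  rintro ⟨i, -, hi⟩
  exact (c i).den_ne_zero hi

lemma exists_castVec_eq_denv_smul {d : ℕ} (c : Fin d → ℚ) :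
    ∃ m : Fin d → ℤ, castVec m = (denv c : ℝ) • ratVec c := by
  have hdvd (i : Fin d) : (c i).den ∣ denv c := Finset.dvd_lcm (Finset.mem_univ i)
  choose q hq using hdvd
  refine ⟨fun i => q i * (c i).num, ?_⟩
  ext i
  have h : ((c i).den : ℚ) * c i = (c i).num := Rat.den_mul_eq_num (c i)
  simp only [castVec, ratVec, Pi.smul_apply, smul_eq_mul, hq i]
  have h' : ((c i).den : ℝ) * (c i : ℝ) = (c i).num := by exact_mod_cast h
  push_cast
  rw [← h']
  ring

lemma ehr_eq_latCount {d : ℕ} (P : Set (Fin d → ℝ)) (c : Fin d → ℚ) (k : ℤ) (t : ℕ)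
    (h : (t : ℤ) ≡ k [ZMOD denv c]) :
    ehr P c t = latCount ((k • ratVec c) +ᵥ (t : ℝ) • P) := by
  obtain ⟨m, hm⟩ := exists_castVec_eq_denv_smul c
  obtain ⟨q, hq⟩ := h.symm.dvd
  have hcast : castVec (q • m) = ((t : ℤ) - k) • ratVec c := by
    rw [hq]
    ext i
    have hmi : (m i : ℝ) = denv c * ratVec c i := congrFun hm i
    simp only [castVec, Pi.smul_apply, zsmul_eq_mul]
    push_cast
    rw [hmi]
    ring
  have hset : (t : ℝ) • (ratVec c +ᵥ P) =
      castVec (q • m) +ᵥ ((k • ratVec c) +ᵥ (t : ℝ) • P) := by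
    rw [vadd_vadd, hcast, ← add_smul, sub_add_cancel, natCast_zsmul,
      ← Nat.cast_smul_eq_nsmul ℝ]
    ext x
    simp only [Set.mem_smul_set, Set.mem_vadd_set, vadd_eq_add]
    constructor
    · rintro ⟨_, ⟨y, hy, rfl⟩, rfl⟩
      exact ⟨_, ⟨y, hy, rfl⟩, (smul_add _ _ _).symm⟩
    · rintro ⟨_, ⟨y, hy, rfl⟩, rfl⟩
      exact ⟨_, ⟨y, hy, rfl⟩, smul_add _ _ _⟩
  rw [ehr, hset, latCount_castVec_vadd]

/-- A constituent of the Ehrhart quasi-polynomial of `c + P` is determined by the eventual values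
of the counting function of the translates `kc + tP`. -/
lemma IsConstituents.eq_of_eventually {d : ℕ} {P : Set (Fin d → ℝ)} {c : Fin d → ℚ}
    {f : ℕ → Polynomial ℚ} (hf : IsConstituents (ehr P c) (denv c) f) {k : ℤ} {j : ℕ}
    (hjk : (j : ℤ) ≡ k [ZMOD denv c]) {p : Polynomial ℚ}
    (hp : ∀ᶠ t : ℕ in Filter.atTop,
      (latCount ((k • ratVec c) +ᵥ (t : ℝ) • P) : ℚ) = p.eval (t : ℚ)) :
    f (j % denv c) = p := by
  apply Polynomial.eq_of_infinite_eval_eq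
  obtain ⟨N, hN⟩ := Filter.eventually_atTop.1 hp
  have hρ := denv_pos c
  refine Set.infinite_of_injective_forall_mem (α := ℕ)
    (f := fun s => ((j + denv c * (N + 1 + s) : ℕ) : ℚ)) (fun a b hab => ?_) fun s => ?_
  · have h : j + denv c * (N + 1 + a) = j + denv c * (N + 1 + b) := Nat.cast_injective hab
    have := Nat.eq_of_mul_eq_mul_left hρ (Nat.add_left_cancel h)
    omega
  · have hle : N + 1 + s ≤ denv c * (N + 1 + s) := Nat.le_mul_of_pos_left _ hρ
    have hmod : ((j + denv c * (N + 1 + s) : ℕ) : ℤ) ≡ k [ZMOD denv c] := by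
      refine Int.ModEq.trans ?_ hjk
      push_cast
      exact Int.modEq_iff_dvd.2 ⟨-(N + 1 + s), by ring⟩
    have h1 := hf (j + denv c * (N + 1 + s)) (by omega)
    rw [Nat.add_mul_mod_self_left, ehr_eq_latCount P c k _ hmod, hN _ (by omega)] at h1
    exact h1.symm

/-- For a centrally symmetric lattice polytope `P` and any `c ∈ ℚ^d`, the
Ehrhart quasi-polynomial `L_{c+P}` is symmetric with respect to the period `den(c)`;
equivalently `#((kc + tP) ∩ ℤ^d) = #((−kc + tP) ∩ ℤ^d)` for all integers `k` and all
positive integers `t`. -/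
theorem symmetric_of_centrally_symmetric
    (d : ℕ) (P : Set (Fin d → ℝ)) (hP : IsLatticePolytope P)
    (hsym : CentrallySymmetric P) (c : Fin d → ℚ) :
    SymmetricQP (ehr P c) (denv c) ∧
    ∀ (k : ℤ) (t : ℕ), 0 < t →
      latCount ((k • ratVec c) +ᵥ (t : ℝ) • P) =
        latCount (((-k) • ratVec c) +ᵥ (t : ℝ) • P) := by
  have hcount (k : ℤ) (t : ℕ) : latCount ((k • ratVec c) +ᵥ (t : ℝ) • P) =
      latCount (((-k) • ratVec c) +ᵥ (t : ℝ) • P) := by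
    rw [neg_smul, latCount_vadd_smul_eq_neg hP hsym]
  refine ⟨fun f hf k hk => ?_, fun k t _ => hcount k t⟩
  obtain ⟨p, hp⟩ := hP.eventuallyPolynomial_latCount ((k : ℤ) • ratVec c)
  rw [hf.eq_of_eventually (Int.ModEq.refl _) hp]
  refine (hf.eq_of_eventually (k := -k) ?_ (hp.mono fun t ht => by rwa [← hcount])).symm
  rw [Nat.cast_sub hk]
  exact Int.modEq_iff_dvd.2 ⟨-1, by ring⟩
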